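/- Attainability of finite canonical constraints: let (I, δ) be a timely specification with δ satisfiable, and let ĩ, j̃ ∈ I. If δ̂(ĩ,j̃) < ∞, then there exists t ∈ T(δ) with t(j̃) − t(ĩ) = δ̂(ĩ,j̃). -/

import Mathlib

noncomputable section

/-- `D ≤ ℝ` (an additive subgroup) is closed under infima of nonempty
bounded-below subsets. -/
def ClosedUnderInf (D : AddSubgroup ℝ) : Prop :=
  ∀ S : Set ℝ, S.Nonempty → BddBelow S → S ⊆ (D : Set ℝ) → sInf S ∈ D

/-- A timely constraint on `I`: on every pair of distinct actions, `δ` takes a value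
in `Δ = D ∪ {-∞, +∞}`, viewed inside the extended reals. -/
def IsTimelyConstraint (D : AddSubgroup ℝ) {I : Type*} (δ : I → I → EReal) : Prop :=
  ∀ i j : I, i ≠ j → δ i j = ⊤ ∨ δ i j = ⊥ ∨ ∃ d : ℝ, d ∈ D ∧ δ i j = (d : EReal)

/-- `t : I → ℝ` takes values in `𝕋` (the nonnegative part of `D`) and satisfies the
timely constraint `δ`, i.e. `t j ≤ t i + δ i j` for all distinct `i, j`. -/
def Satisfies (D : AddSubgroup ℝ) {I : Type*} (δ : I → I → EReal) (t : I → ℝ) : Prop :=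
  (∀ i, t i ∈ D) ∧ (∀ i, 0 ≤ t i) ∧
    ∀ i j : I, i ≠ j → (t j : EReal) ≤ (t i : EReal) + δ i j

/-- A path in the graph `G_δ`: a nonempty finite sequence of vertices, each consecutive
pair being an edge, i.e. a pair of distinct vertices with `δ < ∞`. -/
def IsPath {I : Type*} (δ : I → I → EReal) (p : List I) : Prop :=
  p ≠ [] ∧ p.Chain' fun a b => a ≠ b ∧ δ a b < ⊤

/-- The length of a path: the sum of the weights of its edges. -/
def pathLength {I : Type*} (δ : I → I → EReal) (p : List I) : EReal :=
  ((p.zip p.tail).map fun q => δ q.1 q.2).sum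

/-- The canonical form `δ̂` of `δ`: the distance function of `G_δ`, i.e. the infimum in
the extended reals of the lengths of all paths from `i` to `j` (`+∞` if there is none). -/
def canon {I : Type*} (δ : I → I → EReal) (i j : I) : EReal :=
  sInf {L : EReal | ∃ p : List I,
    IsPath δ p ∧ p.head? = some i ∧ p.getLast? = some j ∧ pathLength δ p = L}

/-- A negative cycle in `G_δ`: a path with at least two entries, whose first and last
vertices coincide, of negative length. -/
def IsNegativeCycle {I : Type*} (δ : I → I → EReal) (p : List I) : Prop :=
  IsPath δ p ∧ 2 ≤ p.length ∧ p.head? = p.getLast? ∧ pathLength δ p < 0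

theorem pathLength_cons_cons {I : Type*} (δ : I → I → EReal) (a b : I) (p : List I) :
    pathLength δ (a :: b :: p) = δ a b + pathLength δ (b :: p) := by
  simp [pathLength]

theorem pathLength_concat {I : Type*} (δ : I → I → EReal) (a b : I) (p : List I)
    (h : p.getLast? = some a) : pathLength δ (p ++ [b]) = pathLength δ p + δ a b := by
  induction p with
  | nil => simp at h
  | cons c p ih =>
    cases p with
    | nil =>
      obtain rfl : c = a := by simpa using h
      simp [pathLength]
    | cons d p =>
      have := ih (by simpa using h)
      simp only [List.cons_append] at this ⊢
      rw [pathLength_cons_cons, pathLength_cons_cons, this, add_assoc]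

/-- Under a satisfiable constraint, the weight of an edge is a real number in `D`. -/
theorem Satisfies.exists_edge_eq {D : AddSubgroup ℝ} {I : Type*} {δ : I → I → EReal}
    (hδ : IsTimelyConstraint D δ) {s : I → ℝ} (hs : Satisfies D δ s) {a b : I}
    (hab : a ≠ b) (hlt : δ a b < ⊤) :
    ∃ d ∈ D, δ a b = ((d : ℝ) : EReal) ∧ s b ≤ s a + d := by
  have h := hs.2.2 a b hab
  rcases hδ a b hab with h' | h' | ⟨d, hd, h'⟩
  · simp [h'] at hlt
  · simp [h'] at h
  · rw [h'] at h
    exact ⟨d, hd, h', by exact_mod_cast h⟩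

/-- Under a satisfiable constraint, the length of a path is a real number in `D`. -/
theorem Satisfies.exists_pathLength_eq {D : AddSubgroup ℝ} {I : Type*} {δ : I → I → EReal}
    (hδ : IsTimelyConstraint D δ) {s : I → ℝ} (hs : Satisfies D δ s) {p : List I} {i j : I}
    (hp : IsPath δ p) (hi : p.head? = some i) (hj : p.getLast? = some j) :
    ∃ d ∈ D, pathLength δ p = ((d : ℝ) : EReal) ∧ s j ≤ s i + d := by
  induction p generalizing i with
  | nil => simp at hi
  | cons c p ih =>
    obtain rfl : c = i := by simpa using hi
    cases p with
    | nil =>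
      obtain rfl : c = j := by simpa using hj
      exact ⟨0, D.zero_mem, by simp [pathLength], by simp⟩
    | cons b p =>
      obtain ⟨-, hc⟩ := hp
      obtain ⟨⟨hne, hlt⟩, hc⟩ := List.isChain_cons_cons.1 hc
      obtain ⟨d, hd, hd', hds⟩ := ih (i := b) ⟨by simp, hc⟩ (by simp) (by simpa using hj)
      obtain ⟨e, he, he', hes⟩ := hs.exists_edge_eq hδ hne hlt
      refine ⟨e + d, D.add_mem he hd, ?_, by linarith⟩
      rw [pathLength_cons_cons, hd', he', EReal.coe_add]

/-- Under a satisfiable constraint, a canonical value below `⊤` is a real number in `D`. -/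
theorem Satisfies.exists_canon_eq {D : AddSubgroup ℝ} (hD : ClosedUnderInf D) {I : Type*}
    {δ : I → I → EReal} (hδ : IsTimelyConstraint D δ) {s : I → ℝ} (hs : Satisfies D δ s)
    {i j : I} (hfin : canon δ i j < ⊤) :
    ∃ d ∈ D, canon δ i j = ((d : ℝ) : EReal) ∧ s j ≤ s i + d := by
  set P : Set EReal := {L : EReal | ∃ p : List I,
    IsPath δ p ∧ p.head? = some i ∧ p.getLast? = some j ∧ pathLength δ p = L}
  have hcanon : canon δ i j = sInf P := rfl
  have hreal : ∀ L ∈ P, ∃ d ∈ D, L = ((d : ℝ) : EReal) ∧ s j ≤ s i + d := by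
    rintro L ⟨p, hp, hi, hj, rfl⟩
    exact hs.exists_pathLength_eq hδ hp hi hj
  set S : Set ℝ := {x : ℝ | (x : EReal) ∈ P}
  have hSprop : ∀ x ∈ S, x ∈ D ∧ s j - s i ≤ x := by
    intro x hx
    obtain ⟨d, hd, hxd, hle⟩ := hreal _ hx
    obtain rfl : x = d := by exact_mod_cast hxd
    exact ⟨hd, by linarith⟩
  have hSne : S.Nonempty := by
    rw [hcanon, sInf_lt_iff] at hfin
    obtain ⟨L, hL, -⟩ := hfin
    obtain ⟨d, -, rfl, -⟩ := hreal L hL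
    exact ⟨d, hL⟩
  have hSbdd : BddBelow S := ⟨s j - s i, fun x hx => (hSprop x hx).2⟩
  have hle : s j - s i ≤ sInf S := le_csInf hSne fun x hx => (hSprop x hx).2
  refine ⟨sInf S, hD S hSne hSbdd fun x hx => (hSprop x hx).1, ?_, by linarith⟩
  rw [hcanon]
  apply le_antisymm
  · apply EReal.le_of_forall_lt_iff_le.1
    intro z hz
    obtain ⟨x, hx, hxz⟩ := (csInf_lt_iff hSbdd hSne).1 (EReal.coe_lt_coe_iff.1 hz)
    exact (show sInf P ≤ (x : EReal) from sInf_le hx).trans (EReal.coe_le_coe_iff.2 hxz.le)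
  · refine le_sInf fun L hL => ?_
    obtain ⟨d, -, rfl, -⟩ := hreal L hL
    exact EReal.coe_le_coe_iff.2 (csInf_le hSbdd hL)

theorem canon_self_le_zero {I : Type*} (δ : I → I → EReal) (i : I) : canon δ i i ≤ 0 :=
  sInf_le ⟨[i], ⟨by simp, List.isChain_singleton i⟩, by simp, by simp, by simp [pathLength]⟩

theorem canon_le_add_edge {I : Type*} {δ : I → I → EReal} (i : I) {a b : I} (hab : a ≠ b)
    {e : ℝ} (he : δ a b = (e : EReal)) : canon δ i b ≤ canon δ i a + e := by
  rw [← EReal.sub_le_iff_le_add (by simp) (by simp)]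
  refine le_sInf ?_
  rintro L ⟨p, ⟨hne, hc⟩, hi, ha, rfl⟩
  rw [EReal.sub_le_iff_le_add (by simp) (by simp), ← he, ← pathLength_concat δ a b p ha]
  refine sInf_le ⟨p ++ [b], ⟨by simp, ?_⟩, ?_, by simp, rfl⟩
  · refine List.isChain_append.2 ⟨hc, List.isChain_singleton b, ?_⟩
    intro x hx y hy
    obtain rfl : a = x := by simpa [ha] using hx
    obtain rfl : b = y := by simpa using hy
    exact ⟨hab, by simp [he]⟩
  · simp [List.head?_append, hi]

/-- Attainability of finite canonical constraints: if `δ` is satisfiable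
and `δ̂(i₀,j₀) < ∞`, then some `t ∈ T(δ)` attains `t(j₀) - t(i₀) = δ̂(i₀,j₀)`. -/
theorem canon_attained (D : AddSubgroup ℝ) (hD : ClosedUnderInf D)
    {I : Type*} (δ : I → I → EReal) (hδ : IsTimelyConstraint D δ)
    (hsat : ∃ t : I → ℝ, Satisfies D δ t) (i₀ j₀ : I)
    (hfin : canon δ i₀ j₀ < ⊤) :
    ∃ t : I → ℝ, Satisfies D δ t ∧ ((t j₀ - t i₀ : ℝ) : EReal) = canon δ i₀ j₀ := by
  classical
  obtain ⟨s, hs⟩ := hsat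
  obtain ⟨d, hdD, hd, hds⟩ := hs.exists_canon_eq hD hδ hfin
  have h0 : canon δ i₀ i₀ = 0 := by
    have hle := canon_self_le_zero δ i₀
    obtain ⟨z, -, hz, hzs⟩ :=
      hs.exists_canon_eq hD hδ (hle.trans_lt EReal.zero_lt_top)
    refine le_antisymm hle ?_
    rw [hz]
    exact_mod_cast (by linarith : (0 : ℝ) ≤ z)
  set M : ℝ := s i₀ + d - s j₀ with hM
  have hM0 : 0 ≤ M := by linarith
  have hMD : M ∈ D := D.sub_mem (D.add_mem (hs.1 _) hdD) (hs.1 _)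
  let t : I → ℝ := fun k =>
    if canon δ i₀ k < ⊤ then min (s k + M) (s i₀ + (canon δ i₀ k).toReal) else s k + M
  have ht_eq : ∀ {k : I} {c : ℝ}, canon δ i₀ k = (c : EReal) →
      t k = min (s k + M) (s i₀ + c) := by
    intro k c hc
    simp [t, hc]
  have ht_le : ∀ k, t k ≤ s k + M := by
    intro k
    simp only [t]
    split_ifs
    · exact min_le_left _ _
    · exact le_rfl
  refine ⟨t, ⟨fun k => ?_, fun k => ?_, fun a b hab => ?_⟩, ?_⟩
  · by_cases hk : canon δ i₀ k < ⊤
    · obtain ⟨c, hcD, hc, -⟩ := hs.exists_canon_eq hD hδ hk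
      rw [ht_eq hc]
      rcases min_choice (s k + M) (s i₀ + c) with h | h <;> rw [h]
      · exact D.add_mem (hs.1 k) hMD
      · exact D.add_mem (hs.1 i₀) hcD
    · simpa only [t, if_neg hk] using D.add_mem (hs.1 k) hMD
  · have hk0 := hs.2.1 k
    by_cases hk : canon δ i₀ k < ⊤
    · obtain ⟨c, -, hc, hcs⟩ := hs.exists_canon_eq hD hδ hk
      rw [ht_eq hc]
      exact le_min (by linarith) (by linarith)
    · simp only [t, if_neg hk]
      linarith
  · by_cases hlt : δ a b < ⊤
    · obtain ⟨e, -, he, hes⟩ := hs.exists_edge_eq hδ hab hlt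
      rw [he]
      suffices t b ≤ t a + e by exact_mod_cast this
      have hb := ht_le b
      by_cases ha : canon δ i₀ a < ⊤
      · obtain ⟨c, -, hc, -⟩ := hs.exists_canon_eq hD hδ ha
        have htri := canon_le_add_edge i₀ hab he
        rw [hc, ← EReal.coe_add] at htri
        obtain ⟨c', -, hc', -⟩ :=
          hs.exists_canon_eq hD hδ (htri.trans_lt (EReal.coe_lt_top _))
        rw [hc', EReal.coe_le_coe_iff] at htri
        rw [ht_eq hc, ← min_add_add_right]
        refine le_min (by linarith) ?_
        rw [ht_eq hc']
        exact (min_le_right _ _).trans (by linarith)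
      · simp only [t, if_neg ha] at hb ⊢
        linarith
    · rw [not_lt_top_iff.1 hlt, EReal.coe_add_top]
      exact le_top
  · rw [hd, ht_eq hd, ht_eq (h0.trans EReal.coe_zero.symm), min_eq_right (by linarith),
      min_eq_right (by linarith)]
    congr 1
    ring
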